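/- Let O be a DL-Lite ontology and C ∈ L(∃,⊓,⊤)[Σ_C,Σ_R] a concept satisfiable w.r.t. O. Then there exists a finite pointed interpretation (I_{C,O}, d_C) (the canonical model of C under O) such that: (1) for all concepts D ∈ L(∃,⊓,⊤)[Σ_C,Σ_R], d_C ∈ D^{I_{C,O}} if and only if O ⊨ C ⊑ D (in particular d_C ∈ C^{I_{C,O}}); and (2) I_{C,O} ⊨ O. -/

import Mathlib

namespace DL

/-! ### Syntax of ALCQI concepts -/

/-- Roles: role names (indexed by ℕ) and inverse roles. -/
inductive Role where
  | name : ℕ → Role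
  | inv  : ℕ → Role
deriving DecidableEq

/-- ALCQI concept expressions. -/
inductive Concept where
  | atom : ℕ → Concept
  | top  : Concept
  | bot  : Concept
  | and  : Concept → Concept → Concept
  | or   : Concept → Concept → Concept
  | neg  : Concept → Concept
  | ex   : Role → Concept → Concept
  | all  : Role → Concept → Concept
  | atLeast : ℕ → Role → Concept → Concept
deriving DecidableEq

/-- The operators/constructors that a concept language may use. -/
inductive Op where
  | all | ex | ge | inv | and | or | top | bot | neg
deriving DecidableEq

/-! ### Interpretations and semantics -/

/-- An interpretation: a nonempty domain, interpretations of concept names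
and of role names. -/
structure Interp where
  Δ : Type
  dom_nonempty : Nonempty Δ
  atom : ℕ → Set Δ
  rel : ℕ → Δ → Δ → Prop

def Role.sem (I : Interp) : Role → (I.Δ → I.Δ → Prop)
  | .name R => I.rel R
  | .inv R  => fun d e => I.rel R e d

def Concept.sem (I : Interp) : Concept → Set I.Δ
  | .atom A => I.atom A
  | .top => Set.univ
  | .bot => ∅
  | .and C D => C.sem I ∩ D.sem I
  | .or C D => C.sem I ∪ D.sem I
  | .neg C => (C.sem I)ᶜ
  | .ex S C => {d | ∃ e, S.sem I d e ∧ e ∈ C.sem I}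
  | .all S C => {d | ∀ e, S.sem I d e → e ∈ C.sem I}
  | .atLeast k S C => {d | ∃ s : Finset I.Δ, s.card = k ∧ ∀ e ∈ s, S.sem I d e ∧ e ∈ C.sem I}

/-! ### Concept languages L(Os)[SC, SR] -/

def Role.inSig (Os : Finset Op) (SR : Finset ℕ) : Role → Prop
  | .name R => R ∈ SR
  | .inv R  => Op.inv ∈ Os ∧ R ∈ SR

/-- Membership of a concept in the language `L(Os)[SC, SR]`. -/
def Concept.inLang (Os : Finset Op) (SC SR : Finset ℕ) : Concept → Prop
  | .atom A => A ∈ SC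
  | .top => Op.top ∈ Os
  | .bot => Op.bot ∈ Os
  | .and C D => Op.and ∈ Os ∧ C.inLang Os SC SR ∧ D.inLang Os SC SR
  | .or C D => Op.or ∈ Os ∧ C.inLang Os SC SR ∧ D.inLang Os SC SR
  | .neg C => Op.neg ∈ Os ∧ C.inLang Os SC SR
  | .ex S C => Op.ex ∈ Os ∧ S.inSig Os SR ∧ C.inLang Os SC SR
  | .all S C => Op.all ∈ Os ∧ S.inSig Os SR ∧ C.inLang Os SC SR
  | .atLeast k S C => Op.ge ∈ Os ∧ 1 ≤ k ∧ S.inSig Os SR ∧ C.inLang Os SC SR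

/-! ### DL-Lite ontologies -/

/-- Basic concepts: concept names, ∃R and ∃R⁻. -/
inductive Basic where
  | atom : ℕ → Basic
  | ex : Role → Basic
deriving DecidableEq

def Basic.sem (I : Interp) : Basic → Set I.Δ
  | .atom A => I.atom A
  | .ex S => {d | ∃ e, S.sem I d e}

/-- A DL-Lite concept inclusion `B ⊑ C` where `C` is a basic concept
(`negated = false`) or a negated basic concept (`negated = true`). -/
structure CI where
  lhs : Basic
  rhs : Basic
  negated : Bool
deriving DecidableEq

def CI.sat (I : Interp) (ci : CI) : Prop :=
  if ci.negated then ci.lhs.sem I ⊆ (ci.rhs.sem I)ᶜ else ci.lhs.sem I ⊆ ci.rhs.sem I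

/-- A DL-Lite ontology: a finite set (list) of concept inclusions. -/
abbrev Ontology := List CI

def Interp.satO (I : Interp) (Ont : Ontology) : Prop := ∀ ci ∈ Ont, ci.sat I

/-! ### Pointed interpretations, examples, characterisations -/

structure PInterp where
  I : Interp
  pt : I.Δ

/-- A pointed interpretation is finite if its domain is finite. -/
def PInterp.finite (P : PInterp) : Prop := Finite P.I.Δ

/-- `C` fits a collection `(Epos, Eneg)` of labelled examples. -/
def Fits (C : Concept) (Epos Eneg : List PInterp) : Prop :=
  (∀ e ∈ Epos, e.pt ∈ C.sem e.I) ∧ (∀ e ∈ Eneg, e.pt ∉ C.sem e.I)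

/-- Equivalence of concepts. -/
def CEquiv (C D : Concept) : Prop := ∀ I : Interp, C.sem I = D.sem I

/-- Equivalence of concepts relative to an ontology. -/
def CEquivO (Ont : Ontology) (C D : Concept) : Prop :=
  ∀ I : Interp, I.satO Ont → C.sem I = D.sem I

/-- `⊨ C ⊑ D`. -/
def Subsumes (C D : Concept) : Prop := ∀ I : Interp, C.sem I ⊆ D.sem I

/-- `Ont ⊨ C ⊑ D`. -/
def SubsumesO (Ont : Ontology) (C D : Concept) : Prop :=
  ∀ I : Interp, I.satO Ont → C.sem I ⊆ D.sem I

/-- `(Epos, Eneg)` is a finite characterisation of `C` w.r.t. the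
concept language (predicate) `L`: all examples are finite, `C` fits,
and every fitting concept of `L` is equivalent to `C`. -/
def FinChar (L : Concept → Prop) (C : Concept) (Epos Eneg : List PInterp) : Prop :=
  (∀ e ∈ Epos ++ Eneg, e.finite) ∧
  Fits C Epos Eneg ∧
  ∀ D, L D → Fits D Epos Eneg → CEquiv C D

/-- Finite characterisation of `C` w.r.t. `L` under an ontology `Ont`:
all examples are finite and satisfy `Ont`, `C` fits, and every fitting
concept of `L` is equivalent to `C` relative to `Ont`. -/
def FinCharO (Ont : Ontology) (L : Concept → Prop) (C : Concept)
    (Epos Eneg : List PInterp) : Prop :=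
  (∀ e ∈ Epos ++ Eneg, e.finite ∧ e.I.satO Ont) ∧
  Fits C Epos Eneg ∧
  ∀ D, L D → Fits D Epos Eneg → CEquivO Ont C D

/-- `L(Os)` admits finite characterisations. -/
def AdmitsFinChar (Os : Finset Op) : Prop :=
  ∀ SC SR : Finset ℕ, ∀ C : Concept, C.inLang Os SC SR →
    ∃ Epos Eneg : List PInterp, FinChar (Concept.inLang Os SC SR) C Epos Eneg

/-- `L(Os)` admits finite characterisations under the ontology `Ont`. -/
def AdmitsFinCharO (Os : Finset Op) (Ont : Ontology) : Prop :=
  ∀ SC SR : Finset ℕ, ∀ C : Concept, C.inLang Os SC SR →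
    ∃ Epos Eneg : List PInterp, FinCharO Ont (Concept.inLang Os SC SR) C Epos Eneg

/-! ### Size, role depth, number restrictions -/

/-- Number of symbols of a concept expression (numbers in binary). -/
def Concept.size : Concept → ℕ
  | .atom _ => 1
  | .top => 1
  | .bot => 1
  | .and C D => C.size + D.size + 1
  | .or C D => C.size + D.size + 1
  | .neg C => C.size + 1
  | .ex _ C => C.size + 2
  | .all _ C => C.size + 2
  | .atLeast k _ C => C.size + 2 + Nat.size k

/-- Role depth of a concept. -/
def Concept.dp : Concept → ℕ
  | .atom _ => 0
  | .top => 0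
  | .bot => 0
  | .and C D => max C.dp D.dp
  | .or C D => max C.dp D.dp
  | .neg C => C.dp
  | .ex _ C => C.dp + 1
  | .all _ C => C.dp + 1
  | .atLeast _ _ C => C.dp + 1

/-- The largest number occurring in a number restriction of `C` (0 if none). -/
def Concept.nr : Concept → ℕ
  | .atom _ => 0
  | .top => 0
  | .bot => 0
  | .and C D => max C.nr D.nr
  | .or C D => max C.nr D.nr
  | .neg C => C.nr
  | .ex _ C => C.nr
  | .all _ C => C.nr
  | .atLeast k _ C => max k C.nr

/-- The operator set of `L(∃,⊓,⊤)`. -/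
def ELops : Finset Op := {Op.ex, Op.and, Op.top}

/-! ### The canonical model

Domain elements are satisfiable concepts, each in two copies. Copies tagged `false` only have
role edges to copies tagged `false`, and such an edge `(X, Y)` is present only if `X ⊑ ∃R.Y` is
entailed; copies tagged `true` provide the predecessors demanded by inverse roles. -/

/-- The inverse of a role. -/
def Role.flip : Role → Role
  | .name R => .inv R
  | .inv R => .name R

theorem Role.sem_flip (I : Interp) (S : Role) (d e : I.Δ) :
    S.flip.sem I d e ↔ S.sem I e d := by
  cases S <;> rfl

/-- A basic concept as a concept expression. -/
def Basic.toConcept : Basic → Concept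
  | .atom A => .atom A
  | .ex S => .ex S .top

theorem Basic.sem_toConcept (I : Interp) (B : Basic) : B.toConcept.sem I = B.sem I := by
  cases B <;> simp [Basic.toConcept, Concept.sem, Basic.sem]

/-- Satisfiability of a concept with respect to an ontology. -/
def SatisfiableO (Ont : Ontology) (C : Concept) : Prop :=
  ∃ I : Interp, I.satO Ont ∧ (C.sem I).Nonempty

theorem SatisfiableO.of_subsumesO_ex {Ont : Ontology} {X Y : Concept} {S : Role}
    (hX : SatisfiableO Ont X) (h : SubsumesO Ont X (.ex S Y)) : SatisfiableO Ont Y := by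
  obtain ⟨I, hI, d, hd⟩ := hX
  obtain ⟨e, -, he⟩ := h I hI hd
  exact ⟨I, hI, e, he⟩

theorem subsumesO_ex_top {Ont : Ontology} {X Y : Concept} {S : Role}
    (h : SubsumesO Ont X (.ex S Y)) : SubsumesO Ont X (.ex S .top) := by
  intro I hI d hd
  obtain ⟨e, he, -⟩ := h I hI hd
  exact ⟨e, he, trivial⟩

/-- Every filler of an existential restriction may be taken to have an inverse successor. -/
theorem subsumesO_ex_and_flip {Ont : Ontology} {X F : Concept} {S : Role}
    (h : SubsumesO Ont X (.ex S F)) :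
    SubsumesO Ont X (.ex S (.and F (.ex S.flip .top))) := by
  intro I hI d hd
  obtain ⟨e, hde, he⟩ := h I hI hd
  exact ⟨e, hde, he, d, (S.sem_flip I e d).2 hde, trivial⟩

theorem subsumesO_ex_flip {Ont : Ontology} {X : Concept} {S : Role}
    (h : SubsumesO Ont X (.ex S .top)) : SubsumesO Ont X (.ex S (.ex S.flip .top)) := by
  intro I hI d hd
  obtain ⟨e, hde, -, he⟩ := subsumesO_ex_and_flip h I hI hd
  exact ⟨e, hde, he⟩

/-- The elements needed to realise the existential restrictions in a concept. -/
def Concept.fillers : Concept → Set Concept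
  | .and C D => C.fillers ∪ D.fillers
  | .ex S C => insert (.and C (.ex S.flip .top)) C.fillers
  | _ => ∅

theorem Concept.finite_fillers (C : Concept) : C.fillers.Finite := by
  induction C with
  | and C D hC hD => exact hC.union hD
  | ex S C hC => exact hC.insert _
  | _ => exact Set.finite_empty

/-- The elements needed to realise a basic concept. -/
def Basic.fillers : Basic → Set Concept
  | .atom _ => ∅
  | .ex S => {.ex S.flip .top}

theorem Basic.finite_fillers (B : Basic) : B.fillers.Finite := by
  cases B <;> simp [Basic.fillers]

/-- The elements of the canonical model of `C` under `Ont`. -/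
def canonicalNodes (Ont : Ontology) (C : Concept) : Set Concept :=
  {X | X ∈ insert C (C.fillers ∪ ⋃ ci ∈ Ont, ci.rhs.fillers) ∧ SatisfiableO Ont X}

theorem finite_canonicalNodes (Ont : Ontology) (C : Concept) :
    (canonicalNodes Ont C).Finite :=
  ((C.finite_fillers.union (Ont.finite_toSet.biUnion fun ci _ =>
    ci.rhs.finite_fillers)).insert C).subset fun _ h => h.1

/-- The interpretation whose elements are two copies of each concept in `N`. -/
def nodeInterp (Ont : Ontology) (N : Set Concept) (hN : N.Nonempty) : Interp where
  Δ := N × Bool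
  dom_nonempty := ⟨⟨⟨hN.some, hN.some_mem⟩, false⟩⟩
  atom A := {x | SubsumesO Ont x.1 (.atom A)}
  rel R x y :=
    SubsumesO Ont x.1 (.ex (.name R) .top) ∧ SubsumesO Ont y.1 (.ex (.inv R) .top) ∧
      (x.2 = false → y.2 = false ∧ SubsumesO Ont x.1 (.ex (.name R) y.1))

section nodeInterp

variable {Ont : Ontology} {N : Set Concept} {hN : N.Nonempty}

theorem subsumesO_of_mem_basic_sem {B : Basic} {x : (nodeInterp Ont N hN).Δ}
    (h : x ∈ B.sem (nodeInterp Ont N hN)) : SubsumesO Ont x.1 B.toConcept := by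
  match B, h with
  | .atom _, h => exact h
  | .ex (.name _), ⟨_, he⟩ => exact he.1
  | .ex (.inv _), ⟨_, he⟩ => exact he.2.1

theorem mem_basic_sem_of_subsumesO {B : Basic} {x : (nodeInterp Ont N hN).Δ}
    (hsat : SatisfiableO Ont x.1) (hB : ∀ X ∈ B.fillers, SatisfiableO Ont X → X ∈ N)
    (h : SubsumesO Ont x.1 B.toConcept) : x ∈ B.sem (nodeInterp Ont N hN) := by
  cases B with
  | atom A => exact h
  | ex S =>
    have hS := subsumesO_ex_flip h
    have hY := hB _ rfl (hsat.of_subsumesO_ex hS)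
    cases S with
    | name R => exact ⟨(⟨_, hY⟩, false), h, fun _ _ _ hd => hd, fun _ => ⟨rfl, hS⟩⟩
    | inv R => exact ⟨(⟨_, hY⟩, true), fun _ _ _ hd => hd, h, nofun⟩

theorem nodeInterp_satO (hsat : ∀ X ∈ N, SatisfiableO Ont X)
    (hO : ∀ ci ∈ Ont, ∀ X ∈ ci.rhs.fillers, SatisfiableO Ont X → X ∈ N) :
    (nodeInterp Ont N hN).satO Ont := by
  intro ci hci
  unfold CI.sat
  split_ifs with hneg
  · intro x hl hr
    obtain ⟨J, hJ, d, hd⟩ := hsat _ x.1.2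
    have hdl := subsumesO_of_mem_basic_sem hl J hJ hd
    have hdr := subsumesO_of_mem_basic_sem hr J hJ hd
    rw [Basic.sem_toConcept] at hdl hdr
    have hJci := hJ ci hci
    rw [CI.sat, if_pos hneg] at hJci
    exact hJci hdl hdr
  · intro x hl
    refine mem_basic_sem_of_subsumesO (hsat _ x.1.2) (hO ci hci) fun J hJ d hd => ?_
    have hdl := subsumesO_of_mem_basic_sem hl J hJ hd
    have hJci := hJ ci hci
    rw [CI.sat, if_neg hneg] at hJci
    rw [Basic.sem_toConcept] at hdl ⊢
    exact hJci hdl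

theorem mem_sem_of_subsumesO {SC SR : Finset ℕ} (hsat : ∀ X ∈ N, SatisfiableO Ont X)
    {E : Concept} (hE : E.inLang ELops SC SR)
    (hEN : ∀ X ∈ E.fillers, SatisfiableO Ont X → X ∈ N) {X : N}
    (h : SubsumesO Ont X E) : (X, false) ∈ E.sem (nodeInterp Ont N hN) := by
  induction E generalizing X with
  | atom A => exact h
  | top => trivial
  | and C D ihC ihD =>
    exact ⟨ihC hE.2.1 (fun X hX => hEN X (.inl hX)) fun J hJ _ hd => (h J hJ hd).1,
      ihD hE.2.2 (fun X hX => hEN X (.inr hX)) fun J hJ _ hd => (h J hJ hd).2⟩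
  | ex S F ih =>
    cases S with
    | inv R => simp [Concept.inLang, Role.inSig, ELops] at hE
    | name R =>
      have hS := subsumesO_ex_and_flip h
      have hY := hEN _ (.inl rfl) ((hsat _ X.2).of_subsumesO_ex hS)
      exact ⟨(⟨_, hY⟩, false),
        ⟨subsumesO_ex_top h, fun _ _ _ hd => hd.2, fun _ => ⟨rfl, hS⟩⟩,
        ih hE.2.2 (fun X hX => hEN X (.inr hX)) fun _ _ _ hd => hd.1⟩
  | _ => simp [Concept.inLang, ELops] at hE

theorem subsumesO_of_mem_sem {SC SR : Finset ℕ} {D : Concept} (hD : D.inLang ELops SC SR)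
    {X : N} (h : (X, false) ∈ D.sem (nodeInterp Ont N hN)) : SubsumesO Ont X D := by
  induction D generalizing X with
  | atom A => exact h
  | top => exact fun _ _ _ _ => trivial
  | and C D ihC ihD =>
    exact fun J hJ _ hd => ⟨ihC hD.2.1 h.1 J hJ hd, ihD hD.2.2 h.2 J hJ hd⟩
  | ex S F ih =>
    cases S with
    | inv R => simp [Concept.inLang, Role.inSig, ELops] at hD
    | name R =>
      obtain ⟨⟨Y, c⟩, ⟨-, -, hedge⟩, hY⟩ := h
      obtain ⟨rfl, hXY⟩ := hedge rfl
      intro J hJ d hd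
      obtain ⟨e, hde, he⟩ := hXY J hJ hd
      exact ⟨e, hde, ih hD.2.2 hY J hJ he⟩
  | _ => simp [Concept.inLang, ELops] at hD

end nodeInterp

/-- **Theorem (canonical models)**: for every DL-Lite ontology `Ont` and
every `C ∈ L(∃,⊓,⊤)[SC,SR]` satisfiable w.r.t. `Ont`, there is a finite
pointed interpretation (the canonical model of `C` under `Ont`) that
satisfies `Ont`, satisfies `C` at its distinguished point, and satisfies an
`L(∃,⊓,⊤)[SC,SR]`-concept `D` at its distinguished point iff
`Ont ⊨ C ⊑ D`. -/
theorem canonical_model_exists (SC SR : Finset ℕ) (Ont : Ontology)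
    (C : Concept) (hC : C.inLang ELops SC SR)
    (hsat : ∃ I : Interp, I.satO Ont ∧ (C.sem I).Nonempty) :
    ∃ P : PInterp, P.finite ∧ P.I.satO Ont ∧ P.pt ∈ C.sem P.I ∧
      ∀ D : Concept, D.inLang ELops SC SR →
        (P.pt ∈ D.sem P.I ↔ SubsumesO Ont C D) := by
  have hCN : C ∈ canonicalNodes Ont C := ⟨.inl rfl, hsat⟩
  have hN : ∀ X ∈ canonicalNodes Ont C, SatisfiableO Ont X := fun _ hX => hX.2
  have hO : (nodeInterp Ont (canonicalNodes Ont C) ⟨C, hCN⟩).satO Ont :=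
    nodeInterp_satO hN fun _ hci _ hX hXsat =>
      ⟨.inr (.inr (Set.mem_biUnion hci hX)), hXsat⟩
  have hmem : (⟨C, hCN⟩, false) ∈ C.sem (nodeInterp Ont (canonicalNodes Ont C) ⟨C, hCN⟩) :=
    mem_sem_of_subsumesO hN hC (fun _ hX hXsat => ⟨.inr (.inl hX), hXsat⟩) fun _ _ _ => id
  have : Finite (canonicalNodes Ont C) := finite_canonicalNodes Ont C
  exact ⟨⟨nodeInterp Ont (canonicalNodes Ont C) ⟨C, hCN⟩, (⟨C, hCN⟩, false)⟩,
    inferInstanceAs (Finite (canonicalNodes Ont C × Bool)),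
    hO, hmem, fun D hD => ⟨subsumesO_of_mem_sem (hN := ⟨C, hCN⟩) hD, fun h => h _ hO hmem⟩⟩

end DL
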